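/- Let S be a string of length n, let 2 ≤ j ≤ n, Δ ≥ 1, and let p ≥ 2 be a position such that p − Δ, p, and p + Δ all belong to P_{j−1}, no element of P_{j−1} lies strictly between p − Δ and p, and no element of P_{j−1} lies strictly between p and p + Δ (i.e., p and p + Δ are consecutive elements of P_{j−1,Δ}). Then p − 1 ∈ P_j if and only if p + Δ − 1 ∈ P_j. -/

import Mathlib

/-- A string `x` is a generalized palindrome (w.r.t. the involution `f`)
if `x = f(x^R)`. -/
def GenPal {α : Type*} (f : α → α) (x : List α) : Prop :=
  x = (x.reverse).map f

/-- `factor S i j` is the factor `S[i..j]` of `S` (1-based indexing). -/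
def factor {α : Type*} (S : List α) (i j : ℕ) : List α :=
  (S.take j).drop (i - 1)

/-- `Pset f S j` is the set of starting positions of generalized palindromes
ending at position `j` of `S`. -/
def Pset {α : Type*} (f : α → α) (S : List α) (j : ℕ) : Set ℕ :=
  {i | 1 ≤ i ∧ i ≤ j ∧ GenPal f (factor S i j)}

theorem genPal_factor_iff {α : Type*} (f : α → α) (S : List α) (i j : ℕ)
    (hi : 1 ≤ i) (hij : i ≤ j) (hj : j ≤ S.length) :
    GenPal f (factor S i j) ↔
      ∀ a b, a + b + 2 = i + j → i ≤ a + 1 → i ≤ b + 1 → S[a]? = S[b]?.map f := by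
  have hlen : (factor S i j).length = j - (i - 1) := by
    simp [factor, Nat.min_eq_left hj]
  have hget : ∀ c, c < j - (i - 1) → (factor S i j)[c]? = S[i - 1 + c]? := by
    intro c hc
    rw [factor, List.getElem?_drop, List.getElem?_take_of_lt (by omega)]
  unfold GenPal
  constructor
  · intro h a b hab ha hb
    have h' := congrArg (fun l => l[a - (i - 1)]?) h
    simp only [List.getElem?_map] at h'
    rw [List.getElem?_reverse (by omega), hlen, hget _ (by omega), hget _ (by omega)] at h'
    rw [show i - 1 + (a - (i - 1)) = a by omega,
      show i - 1 + (j - (i - 1) - 1 - (a - (i - 1))) = b by omega] at h'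
    exact h'
  · intro h
    apply List.ext_getElem?
    intro c
    by_cases hc : c < j - (i - 1)
    · rw [List.getElem?_map, List.getElem?_reverse (by omega), hlen, hget _ hc,
        hget _ (by omega)]
      exact h _ _ (by omega) (by omega) (by omega)
    · rw [List.getElem?_eq_none (by omega), List.getElem?_eq_none (by simp; omega)]

theorem pred_mem_iff {α : Type*} (f : α → α) (hf : Function.Involutive f)
    (S : List α) (j p : ℕ) (hjn : j ≤ S.length) (hp2 : 2 ≤ p)
    (h2 : p ∈ Pset f S (j - 1)) :
    p - 1 ∈ Pset f S j ↔ S[p - 2]? = S[j - 1]?.map f := by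
  obtain ⟨_, hpj, hpal⟩ := h2
  rw [genPal_factor_iff f S _ _ (by omega) hpj (by omega)] at hpal
  constructor
  · rintro ⟨_, _, h⟩
    rw [genPal_factor_iff f S _ _ (by omega) (by omega) hjn] at h
    exact h _ _ (by omega) (by omega) (by omega)
  · intro h
    refine ⟨by omega, by omega, ?_⟩
    rw [genPal_factor_iff f S _ _ (by omega) (by omega) hjn]
    intro a b hab ha hb
    by_cases h1 : a = p - 2
    · obtain rfl : b = j - 1 := by omega
      rw [h1, h]
    by_cases h3 : b = p - 2
    · obtain rfl : a = j - 1 := by omega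
      rw [h3, h, Option.map_map, hf.comp_self, Option.map_id, id]
    exact hpal a b (by omega) (by omega) (by omega)

/-- If `p` and `p + Δ` are consecutive elements of `P_{j−1,Δ}` (i.e. `p − Δ`, `p`,
`p + Δ` all lie in `P_{j−1}` with no elements of `P_{j−1}` strictly between `p − Δ`
and `p` nor between `p` and `p + Δ`), then `p − 1 ∈ P_j ↔ p + Δ − 1 ∈ P_j`. -/
theorem mem_P_pred_iff {α : Type*} (f : α → α) (hf : Function.Involutive f)
    (S : List α) (j Δ p : ℕ)
    (hj2 : 2 ≤ j) (hjn : j ≤ S.length) (hΔ : 1 ≤ Δ) (hp2 : 2 ≤ p)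
    (h1 : p - Δ ∈ Pset f S (j - 1))
    (h2 : p ∈ Pset f S (j - 1))
    (h3 : p + Δ ∈ Pset f S (j - 1))
    (hgap1 : ∀ m ∈ Pset f S (j - 1), ¬(p - Δ < m ∧ m < p))
    (hgap2 : ∀ m ∈ Pset f S (j - 1), ¬(p < m ∧ m < p + Δ)) :
    p - 1 ∈ Pset f S j ↔ p + Δ - 1 ∈ Pset f S j := by
  rw [pred_mem_iff f hf S j p hjn hp2 h2, pred_mem_iff f hf S j (p + Δ) hjn (by omega) h3]
  obtain ⟨h1a, h1b, h1⟩ := h1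
  obtain ⟨h2a, h2b, h2⟩ := h2
  obtain ⟨h3a, h3b, h3⟩ := h3
  rw [genPal_factor_iff f S _ _ (by omega) (by omega) (by omega)] at h1 h2
  have e1 := h1 (p - 2) (j - 1 - Δ) (by omega) (by omega) (by omega)
  have e2 := h2 (p + Δ - 2) (j - 1 - Δ) (by omega) (by omega) (by omega)
  rw [e1, e2]
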